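/- arXiv:0710.2833 — 4 statements merged into one kernel-verified Lean document; each statement's English description precedes it below -/
import Mathlib

section
/- Assume Σ_{n=1}^N b_n = 0 and ∏_{n=1}^N a_n = 1. Then the Lyapunov function Δ(λ) is a monic polynomial of degree N in λ, its coefficient of λ^{N−1} is 0, and its coefficient of λ^{N−2} equals −H/2, where H = Σ_{n=1}^N (b_n² + 2a_n²). -/
open Polynomial

/-- Solutions of the three-term recurrence
`a (n-1) * y (n-1) + a n * y (n+1) + b n * y n = λ * y n`,
as polynomials in `λ`, with prescribed values at `0` and `1`. -/
noncomputable def jacobiSol (a b : ℤ → ℝ) (y₀ y₁ : Polynomial ℝ) : ℕ → Polynomial ℝ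
  | 0 => y₀
  | 1 => y₁
  | n + 2 =>
      Polynomial.C (a ((n : ℤ) + 1))⁻¹ *
        ((Polynomial.X - Polynomial.C (b ((n : ℤ) + 1))) * jacobiSol a b y₀ y₁ (n + 1)
          - Polynomial.C (a (n : ℤ)) * jacobiSol a b y₀ y₁ n)

/-- The fundamental solution `φ_n` (with `φ_0 = 0`, `φ_1 = 1`). -/
noncomputable def jphi (a b : ℤ → ℝ) : ℕ → Polynomial ℝ := jacobiSol a b 0 1

/-- The fundamental solution `ϑ_n` (with `ϑ_0 = 1`, `ϑ_1 = 0`). -/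
noncomputable def jtheta (a b : ℤ → ℝ) : ℕ → Polynomial ℝ := jacobiSol a b 1 0

/-- The Lyapunov function `Δ = φ_{N+1} + ϑ_N`. -/
noncomputable def jlyap (N : ℕ) (a b : ℤ → ℝ) : Polynomial ℝ := jphi a b (N + 1) + jtheta a b N

/-- `u` is `N`-periodic. -/
def IsPeriodicSeq (N : ℕ) (u : ℤ → ℝ) : Prop := ∀ n : ℤ, u (n + N) = u n

/-- The monic orthogonal polynomials with recurrence coefficients `β`, `γ`. -/
noncomputable def monicRecPoly {R : Type*} [CommRing R] (β γ : ℕ → R) : ℕ → R[X]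
  | 0 => 1
  | 1 => X - C (β 0)
  | n + 2 => (X - C (β (n + 1))) * monicRecPoly β γ (n + 1) - C (γ n) * monicRecPoly β γ n

section MonicRecPoly

variable {R : Type*} [CommRing R] (β γ : ℕ → R)

theorem coeff_monicRecPoly_succ_succ (n k : ℕ) :
    (monicRecPoly β γ (n + 2)).coeff (k + 1) =
      (monicRecPoly β γ (n + 1)).coeff k - β (n + 1) * (monicRecPoly β γ (n + 1)).coeff (k + 1)
        - γ n * (monicRecPoly β γ n).coeff (k + 1) := by
  simp [monicRecPoly, sub_mul]

theorem coeff_monicRecPoly_of_lt {n k : ℕ} (h : n < k) : (monicRecPoly β γ n).coeff k = 0 := by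
  induction n using Nat.twoStepInduction generalizing k with
  | zero => simp [monicRecPoly, coeff_one, h.ne']
  | one =>
    obtain ⟨k, rfl⟩ : ∃ j, k = j + 2 := ⟨k - 2, by omega⟩
    simp [monicRecPoly, coeff_X]
  | more n ih₀ ih₁ =>
    obtain ⟨k, rfl⟩ : ∃ j, k = j + 1 := ⟨k - 1, by omega⟩
    rw [coeff_monicRecPoly_succ_succ, ih₁ (by omega), ih₁ (by omega), ih₀ (by omega)]
    ring

theorem coeff_monicRecPoly_self (n : ℕ) : (monicRecPoly β γ n).coeff n = 1 := by
  induction n using Nat.twoStepInduction with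
  | zero => simp [monicRecPoly]
  | one => simp [monicRecPoly]
  | more n _ ih =>
    rw [coeff_monicRecPoly_succ_succ, ih, coeff_monicRecPoly_of_lt β γ (by omega),
      coeff_monicRecPoly_of_lt β γ (by omega)]
    ring

theorem coeff_monicRecPoly_succ_self (n : ℕ) :
    (monicRecPoly β γ (n + 1)).coeff n = -∑ k ∈ Finset.range (n + 1), β k := by
  induction n with
  | zero => simp [monicRecPoly]
  | succ n ih =>
    rw [coeff_monicRecPoly_succ_succ, ih, coeff_monicRecPoly_self,
      coeff_monicRecPoly_of_lt β γ (by omega), Finset.sum_range_succ _ (n + 1)]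
    ring

theorem two_mul_coeff_monicRecPoly_add_two_self (n : ℕ) :
    2 * (monicRecPoly β γ (n + 2)).coeff n =
      (∑ k ∈ Finset.range (n + 2), β k) ^ 2 - ∑ k ∈ Finset.range (n + 2), β k ^ 2
        - 2 * ∑ k ∈ Finset.range (n + 1), γ k := by
  induction n with
  | zero =>
    simp [monicRecPoly, Finset.sum_range_succ, mul_coeff_zero]
    ring
  | succ n ih =>
    rw [coeff_monicRecPoly_succ_succ, coeff_monicRecPoly_self, coeff_monicRecPoly_succ_self]
    simp only [Finset.sum_range_succ] at ih ⊢
    linear_combination ih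

end MonicRecPoly

section JacobiSol

variable {a : ℤ → ℝ} (b : ℤ → ℝ)

theorem C_mul_jacobiSol_add_two (ha : ∀ n, 0 < a n) (y₀ y₁ : ℝ[X]) (n : ℕ) :
    C (a ((n : ℤ) + 1)) * jacobiSol a b y₀ y₁ (n + 2) =
      (X - C (b ((n : ℤ) + 1))) * jacobiSol a b y₀ y₁ (n + 1)
        - C (a (n : ℤ)) * jacobiSol a b y₀ y₁ n := by
  rw [jacobiSol, ← mul_assoc, ← C_mul, mul_inv_cancel₀ (ha _).ne', C_1, one_mul]

theorem C_prod_mul_jphi_succ (ha : ∀ n, 0 < a n) (n : ℕ) :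
    C (∏ k ∈ Finset.range n, a ((k : ℤ) + 1)) * jphi a b (n + 1) =
      monicRecPoly (fun k ↦ b ((k : ℤ) + 1)) (fun k ↦ a ((k : ℤ) + 1) ^ 2) n := by
  induction n using Nat.twoStepInduction with
  | zero => simp [monicRecPoly, jphi, jacobiSol]
  | one =>
    have h := C_mul_jacobiSol_add_two b ha 0 1 0
    simpa [monicRecPoly, jphi, jacobiSol] using h
  | more n ih₀ ih₁ =>
    have h := C_mul_jacobiSol_add_two b ha 0 1 (n + 1)
    rw [monicRecPoly, ← ih₀, ← ih₁]
    simp only [Finset.prod_range_succ, C_mul, C_pow, jphi] at h ⊢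
    push_cast at h ⊢
    linear_combination
      C (∏ k ∈ Finset.range n, a ((k : ℤ) + 1)) * C (a ((n : ℤ) + 1)) * h

theorem C_prod_mul_jtheta_add_two (ha : ∀ n, 0 < a n) (n : ℕ) :
    C (∏ k ∈ Finset.range (n + 1), a ((k : ℤ) + 1)) * jtheta a b (n + 2) =
      -C (a 0) *
        monicRecPoly (fun k ↦ b ((k : ℤ) + 2)) (fun k ↦ a ((k : ℤ) + 2) ^ 2) n := by
  induction n using Nat.twoStepInduction with
  | zero =>
    have h := C_mul_jacobiSol_add_two b ha 1 0 0
    simpa [monicRecPoly, jtheta, jacobiSol] using h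
  | one =>
    have h₀ := C_mul_jacobiSol_add_two b ha 1 0 0
    have h₁ := C_mul_jacobiSol_add_two b ha 1 0 1
    have h : jacobiSol a b 1 0 1 = 0 := by rw [jacobiSol]
    have h' : jacobiSol a b 1 0 0 = 1 := by rw [jacobiSol]
    simp only [Finset.prod_range_succ, Finset.prod_range_zero, C_mul, jtheta, monicRecPoly, h, h',
      C_1] at h₀ h₁ ⊢
    norm_num at h₀ h₁ ⊢
    linear_combination C (a 1) * h₁ + (X - C (b 2)) * h₀
  | more n ih₀ ih₁ =>
    have h := C_mul_jacobiSol_add_two b ha 1 0 (n + 2)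
    rw [monicRecPoly, mul_sub, mul_left_comm (-C (a 0)), ← ih₁, mul_left_comm (-C (a 0)), ← ih₀]
    simp only [Finset.prod_range_succ, C_mul, C_pow, jtheta] at h ⊢
    push_cast at h ⊢
    simp only [add_assoc] at h ⊢
    norm_num at h ⊢
    linear_combination
      (∏ k ∈ Finset.range n, C (a ((k : ℤ) + 1))) * C (a ((n : ℤ) + 1)) *
        C (a ((n : ℤ) + 2)) * h

theorem jlyap_add_two (ha : ∀ n, 0 < a n) (n : ℕ) (hap : IsPeriodicSeq (n + 2) a)
    (haprod : ∏ k ∈ Finset.range (n + 2), a ((k : ℤ) + 1) = 1) :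
    jlyap (n + 2) a b =
      monicRecPoly (fun k ↦ b ((k : ℤ) + 1)) (fun k ↦ a ((k : ℤ) + 1) ^ 2) (n + 2) -
        C (a ((n : ℤ) + 2) ^ 2) *
          monicRecPoly (fun k ↦ b ((k : ℤ) + 2)) (fun k ↦ a ((k : ℤ) + 2) ^ 2) n := by
  have hphi := C_prod_mul_jphi_succ b ha (n + 2)
  have htheta := C_prod_mul_jtheta_add_two b ha n
  have h₀ : a ((n : ℤ) + 2) = a 0 := by simpa using hap 0
  rw [haprod, C_1, one_mul] at hphi
  rw [Finset.prod_range_succ, show ((n + 1 : ℕ) : ℤ) + 1 = n + 2 by push_cast; ring] at haprod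
  have hC := congrArg (C : ℝ → ℝ[X]) haprod
  rw [C_mul, C_1] at hC
  rw [jlyap, hphi, C_pow]
  rw [← h₀] at htheta
  linear_combination C (a ((n : ℤ) + 2)) * htheta - jtheta a b (n + 2) * hC

end JacobiSol

/-- If `Σ b_n = 0` and `∏ a_n = 1`, the Lyapunov function `Δ` is a monic polynomial of
degree `N`, its coefficient of `λ^{N−1}` vanishes and its coefficient of `λ^{N−2}` is `−H/2`
with `H = Σ_{n=1}^N (b_n² + 2 a_n²)`. -/
theorem lyapunov_expansion (N : ℕ) (hN : 2 ≤ N) (a b : ℤ → ℝ)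
    (ha : ∀ n : ℤ, 0 < a n) (hap : IsPeriodicSeq N a) (hbp : IsPeriodicSeq N b)
    (hbsum : ∑ n ∈ Finset.range N, b ((n : ℤ) + 1) = 0)
    (haprod : ∏ n ∈ Finset.range N, a ((n : ℤ) + 1) = 1) :
    (jlyap N a b).Monic ∧ (jlyap N a b).natDegree = N ∧
    (jlyap N a b).coeff (N - 1) = 0 ∧
    (jlyap N a b).coeff (N - 2) =
      -(∑ n ∈ Finset.range N, (b ((n : ℤ) + 1) ^ 2 + 2 * a ((n : ℤ) + 1) ^ 2)) / 2 := by
  obtain ⟨m, rfl⟩ : ∃ m, N = m + 2 := ⟨N - 2, by omega⟩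
  rw [jlyap_add_two b ha m hap haprod]
  set β : ℕ → ℝ := fun k ↦ b ((k : ℤ) + 1)
  set γ : ℕ → ℝ := fun k ↦ a ((k : ℤ) + 1) ^ 2
  set Q := monicRecPoly (fun k ↦ b ((k : ℤ) + 2)) (fun k ↦ a ((k : ℤ) + 2) ^ 2) m
  have hQ {k : ℕ} (hk : m < k) : Q.coeff k = 0 := coeff_monicRecPoly_of_lt _ _ hk
  have htop : (monicRecPoly β γ (m + 2) - C (a ((m : ℤ) + 2) ^ 2) * Q).coeff (m + 2) = 1 := by
    rw [coeff_sub, coeff_C_mul, hQ (by omega), coeff_monicRecPoly_self]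
    ring
  have hdeg : (monicRecPoly β γ (m + 2) - C (a ((m : ℤ) + 2) ^ 2) * Q).natDegree ≤ m + 2 :=
    natDegree_le_iff_coeff_eq_zero.2 fun k hk ↦ by
      rw [coeff_sub, coeff_C_mul, hQ (by omega), coeff_monicRecPoly_of_lt _ _ hk]
      ring
  refine ⟨monic_of_natDegree_le_of_coeff_eq_one _ hdeg htop,
    natDegree_eq_of_le_of_coeff_ne_zero hdeg (htop ▸ one_ne_zero), ?_, ?_⟩
  · rw [show m + 2 - 1 = m + 1 by omega, coeff_sub, coeff_C_mul, hQ (by omega),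
      coeff_monicRecPoly_succ_self, hbsum]
    ring
  · have h := two_mul_coeff_monicRecPoly_add_two_self β γ m
    have hQm : Q.coeff m = 1 := coeff_monicRecPoly_self _ _ m
    have hlast : γ (m + 1) = a ((m : ℤ) + 2) ^ 2 := by
      simp only [γ]
      push_cast
      ring_nf
    have hsum := Finset.sum_range_succ γ (m + 1)
    rw [hbsum] at h
    rw [Nat.add_sub_cancel, coeff_sub, coeff_C_mul, hQm, Finset.sum_add_distrib,
      ← Finset.mul_sum]
    linear_combination h / 2 + hsum + hlast
end

section
/- Let μ ∈ ℝ be a zero of ϑ_{N+1} and let s ∈ ℤ be such that (−1)^s ϑ_N(μ) > 0. Then φ_{N+1}(μ) ϑ_N(μ) = 1 and (−1)^s Δ(μ) = 2 cosh( log((−1)^s ϑ_N(μ)) ). -/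
open Polynomial

/-- Constancy of the weighted Wronskian of the two fundamental solutions. -/
theorem jtheta_jphi_wronskian (a b : ℤ → ℝ) (ha : ∀ n, a n ≠ 0) (x : ℝ) (n : ℕ) :
    a n * ((jtheta a b n).eval x * (jphi a b (n + 1)).eval x
      - (jphi a b n).eval x * (jtheta a b (n + 1)).eval x) = a 0 := by
  induction n with
  | zero => simp [jtheta, jphi, jacobiSol]
  | succ n ih =>
    have h := ha ((n : ℤ) + 1)
    rw [← ih]
    simp only [jtheta, jphi, jacobiSol, eval_mul, eval_sub, eval_C, eval_X, Nat.cast_add,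
      Nat.cast_one]
    field_simp
    ring

/-- If `μ` is a real zero of `ϑ_{N+1}` and `(−1)^s ϑ_N(μ) > 0`, then
`φ_{N+1}(μ) ϑ_N(μ) = 1` and `(−1)^s Δ(μ) = 2 cosh(log((−1)^s ϑ_N(μ)))`. -/
theorem eval_at_dirichlet_eigenvalue (N : ℕ) (hN : 2 ≤ N) (a b : ℤ → ℝ)
    (ha : ∀ n : ℤ, 0 < a n) (hap : IsPeriodicSeq N a) (hbp : IsPeriodicSeq N b)
    (μ : ℝ) (hμ : (jtheta a b (N + 1)).eval μ = 0)
    (s : ℤ) (hs : 0 < (-1 : ℝ) ^ s * (jtheta a b N).eval μ) :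
    (jphi a b (N + 1)).eval μ * (jtheta a b N).eval μ = 1 ∧
    (-1 : ℝ) ^ s * (jlyap N a b).eval μ =
      2 * Real.cosh (Real.log ((-1 : ℝ) ^ s * (jtheta a b N).eval μ)) := by
  have hW := jtheta_jphi_wronskian a b (fun n => (ha n).ne') μ N
  have haN : a N = a 0 := by simpa using hap 0
  rw [hμ, haN, mul_zero, sub_zero] at hW
  have hdet : (jphi a b (N + 1)).eval μ * (jtheta a b N).eval μ = 1 := by
    rw [mul_comm]
    exact mul_left_cancel₀ (ha 0).ne' (hW.trans (mul_one _).symm)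
  refine ⟨hdet, ?_⟩
  have hinv : ((-1 : ℝ) ^ s)⁻¹ = (-1) ^ s := by
    rw [← inv_zpow, inv_neg_one]
  rw [Real.cosh_log hs, mul_inv, hinv, inv_eq_of_mul_eq_one_left hdet, jlyap, eval_add]
  ring
end

section
/- Assume the polynomial Δ(λ)² − 4 has 2N real zeros labeled λ_0^+ < λ_1^- ≤ λ_1^+ < λ_2^- ≤ … ≤ λ_{N−1}^+ < λ_N^-, with (−1)^{N−n}Δ(λ_n^±) = 2 for each n. Then for each n ∈ {1,…,N−1} there exists a unique λ_n ∈ [λ_n^-, λ_n^+] with Δ'(λ_n) = 0; moreover Δ''(λ_n) ≠ 0 and (−1)^{N−n}Δ(λ_n) ≥ 2. -/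
open Polynomial

/-- A solution of the recurrence with constant initial data has degree at most `n - 1` at index
`n`. -/
theorem natDegree_jacobiSol_le (a b : ℤ → ℝ) {y₀ y₁ : Polynomial ℝ} (h₀ : y₀.natDegree = 0)
    (h₁ : y₁.natDegree = 0) (n : ℕ) :
    (jacobiSol a b y₀ y₁ n).natDegree ≤ n - 1 := by
  induction n using Nat.strong_induction_on with
  | _ n ih =>
    match n with
    | 0 => simp [jacobiSol, h₀]
    | 1 => simp [jacobiSol, h₁]
    | n + 2 =>
      rw [jacobiSol]
      refine (natDegree_C_mul_le _ _).trans ((natDegree_sub_le _ _).trans (max_le ?_ ?_))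
      · have h := ih (n + 1) (by omega)
        have hX := natDegree_X_sub_C_le (b ((n : ℤ) + 1))
        have hmul := natDegree_mul_le (p := X - C (b ((n : ℤ) + 1)))
          (q := jacobiSol a b y₀ y₁ (n + 1))
        omega
      · have h := ih n (by omega)
        have hC := natDegree_C_mul_le (a (n : ℤ)) (jacobiSol a b y₀ y₁ n)
        omega

theorem natDegree_jlyap_le (N : ℕ) (a b : ℤ → ℝ) : (jlyap N a b).natDegree ≤ N := by
  refine (natDegree_add_le _ _).trans (max_le ?_ ?_)
  · exact natDegree_jacobiSol_le a b (y₀ := 0) (y₁ := 1) (by simp) (by simp) (N + 1)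
  · exact (natDegree_jacobiSol_le a b (y₀ := 1) (y₁ := 0) (by simp) (by simp) N).trans
      (Nat.sub_le _ _)

/-- A polynomial with as many distinct roots as its degree allows has no other roots, and all of
them are simple. -/
theorem Polynomial.exists_eq_and_derivative_ne_zero_of_card {q : Polynomial ℝ} (hq : q ≠ 0)
    {s : Finset ℕ} {c : ℕ → ℝ} (hc : Set.InjOn c s) (hroot : ∀ k ∈ s, q.eval (c k) = 0)
    (hdeg : q.natDegree ≤ s.card) {t : ℝ} (ht : q.eval t = 0) :
    (∃ k ∈ s, c k = t) ∧ (derivative q).eval t ≠ 0 := by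
  classical
  have hle : (s.image c).val ≤ q.roots := by
    rw [Multiset.le_iff_subset (s.image c).nodup]
    intro x hx
    obtain ⟨k, hk, rfl⟩ := Finset.mem_image.mp (Finset.mem_val.mp hx)
    exact (mem_roots hq).mpr (hroot k hk)
  have heq : (s.image c).val = q.roots := by
    refine Multiset.eq_of_le_of_card_le hle ?_
    rw [Finset.card_val, Finset.card_image_of_injOn hc]
    exact (card_roots' q).trans hdeg
  refine ⟨?_, fun hd => ?_⟩
  · have hmem : t ∈ q.roots := (mem_roots hq).mpr ht
    rw [← heq] at hmem
    simpa using hmem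
  · have hmul := (one_lt_rootMultiplicity_iff_isRoot hq).mpr ⟨ht, hd⟩
    have hcount := Multiset.nodup_iff_count_le_one.mp (heq ▸ (s.image c).nodup) t
    rw [count_roots] at hcount
    omega

theorem Polynomial.exists_slope_eq_derivative_eval (p : Polynomial ℝ) {x y : ℝ} (hxy : x < y) :
    ∃ z ∈ Set.Ioo x y, (derivative p).eval z * (y - x) = p.eval y - p.eval x := by
  obtain ⟨z, hz, h⟩ := exists_hasDerivAt_eq_slope (fun u => p.eval u)
    (fun u => (derivative p).eval u) hxy p.continuous.continuousOn (fun u _ => p.hasDerivAt u)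
  refine ⟨z, hz, ?_⟩
  rw [h, div_mul_cancel₀ _ (sub_pos.mpr hxy).ne']

/-- If `f x < f l` and `f` has no critical point in `(x, t)`, where `x < l ≤ t`,
then `f l ≤ f t`. -/
theorem Polynomial.eval_le_eval_of_derivative_ne_zero (f : Polynomial ℝ) {x l t : ℝ}
    (hxl : x < l) (hlt : l ≤ t) (hf : f.eval x < f.eval l)
    (hcrit : ∀ z ∈ Set.Ioo x t, (derivative f).eval z ≠ 0) : f.eval l ≤ f.eval t := by
  by_contra! hlt'
  have hlt : l < t := lt_of_le_of_ne hlt (by rintro rfl; exact lt_irrefl _ hlt')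
  obtain ⟨y, hy, hy'⟩ := f.exists_slope_eq_derivative_eval hxl
  obtain ⟨z, hz, hz'⟩ := f.exists_slope_eq_derivative_eval hlt
  have hypos : 0 < (derivative f).eval y :=
    pos_of_mul_pos_left (by rw [hy']; linarith) (sub_pos.mpr hxl).le
  have hzneg : (derivative f).eval z < 0 := by
    by_contra! h
    have := mul_nonneg h (sub_pos.mpr hlt).le
    linarith
  obtain ⟨r, hr, hr'⟩ := intermediate_value_Icc' (hy.2.trans hz.1).le
    (derivative f).continuous.continuousOn ⟨hzneg.le, hypos.le⟩
  exact hcrit r ⟨hy.1.trans_le hr.1, hr.2.trans_lt hz.2⟩ hr'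

/-- Assume `Δ² − 4` has `2N` real zeros labeled
`λ_0^+ < λ_1^- ≤ λ_1^+ < λ_2^- ≤ … ≤ λ_{N−1}^+ < λ_N^-` with `(−1)^{N−n} Δ(λ_n^±) = 2`.
Then for each `1 ≤ n ≤ N−1` there is a unique `λ_n ∈ [λ_n^-, λ_n^+]` with `Δ'(λ_n) = 0`;
moreover `Δ''(λ_n) ≠ 0` and `(−1)^{N−n} Δ(λ_n) ≥ 2`.
Here `lp n` stands for `λ_n^+` (for `0 ≤ n ≤ N−1`) and `lm n` for `λ_n^-` (for `1 ≤ n ≤ N`). -/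
theorem critical_point_in_gap (N : ℕ) (hN : 2 ≤ N) (a b : ℤ → ℝ)
    (ha : ∀ n : ℤ, 0 < a n) (hap : IsPeriodicSeq N a) (hbp : IsPeriodicSeq N b)
    (lm lp : ℕ → ℝ)
    (hroots : ((jlyap N a b) ^ 2 - Polynomial.C 4).roots =
      (Multiset.range N).map lp + (Multiset.range N).map (fun n => lm (n + 1)))
    (horder₁ : ∀ n : ℕ, 1 ≤ n → n ≤ N → lp (n - 1) < lm n)
    (horder₂ : ∀ n : ℕ, 1 ≤ n → n ≤ N - 1 → lm n ≤ lp n)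
    (hΔm : ∀ n : ℕ, 1 ≤ n → n ≤ N → (-1 : ℝ) ^ (N - n) * (jlyap N a b).eval (lm n) = 2)
    (hΔp : ∀ n : ℕ, n ≤ N - 1 → (-1 : ℝ) ^ (N - n) * (jlyap N a b).eval (lp n) = 2) :
    ∀ n : ℕ, 1 ≤ n → n ≤ N - 1 →
      (∃! t : ℝ, t ∈ Set.Icc (lm n) (lp n) ∧
        (Polynomial.derivative (jlyap N a b)).eval t = 0) ∧
      (∀ t ∈ Set.Icc (lm n) (lp n), (Polynomial.derivative (jlyap N a b)).eval t = 0 →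
        (Polynomial.derivative (Polynomial.derivative (jlyap N a b))).eval t ≠ 0 ∧
        2 ≤ (-1 : ℝ) ^ (N - n) * (jlyap N a b).eval t) := by
  set p := jlyap N a b
  have hlp : ∀ m k : ℕ, k ≤ m → m ≤ N - 1 → lp k ≤ lp m := by
    intro m k hkm
    induction m, hkm using Nat.le_induction with
    | base => exact fun _ => le_rfl
    | succ m _ ih =>
      intro hm
      have h₁ := horder₁ (m + 1) (by omega) (by omega)
      have h₂ := horder₂ (m + 1) (by omega) hm
      rw [Nat.add_sub_cancel] at h₁
      linarith [ih (by omega)]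
  have hgap : ∀ k m : ℕ, k < m → m ≤ N - 1 → lp k < lm m := fun k m hkm hm =>
    (hlp (m - 1) k (by omega) (by omega)).trans_lt (horder₁ m (by omega) (by omega))
  have hsign : ∀ k : ℕ, ((-1 : ℝ) ^ k) * (-1) ^ k = 1 := fun k => by
    rw [← mul_pow]; simp
  have hval : ∀ k x, (-1 : ℝ) ^ k * p.eval x = 2 → p.eval x = 2 * (-1) ^ k := fun k x h => by
    linear_combination (-1 : ℝ) ^ k * h - p.eval x * hsign k
  have hprev : ∀ n : ℕ, 1 ≤ n → n ≤ N - 1 → (-1 : ℝ) ^ (N - n) * p.eval (lp (n - 1)) = -2 := by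
    intro n hn hnN
    have h := hΔp (n - 1) (by omega)
    rw [show N - (n - 1) = N - n + 1 by omega, pow_succ] at h
    linarith
  have hcrit : ∀ k : ℕ, ∃ c : ℝ, k ∈ Finset.Icc 1 (N - 1) →
      c ∈ Set.Icc (lm k) (lp k) ∧ (derivative p).eval c = 0 := by
    intro k
    by_cases hk : k ∈ Finset.Icc 1 (N - 1)
    swap
    · exact ⟨0, fun h => absurd h hk⟩
    obtain ⟨hk₁, hk₂⟩ := Finset.mem_Icc.mp hk
    have hm := hval _ _ (hΔm k hk₁ (by omega))
    have hpk := hval _ _ (hΔp k hk₂)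
    rcases (horder₂ k hk₁ hk₂).lt_or_eq with hlt | heq
    · obtain ⟨c, hc, hc'⟩ := p.exists_slope_eq_derivative_eval hlt
      rw [hm, hpk, sub_self] at hc'
      exact ⟨c, fun _ => ⟨Set.Ioo_subset_Icc_self hc,
        (mul_eq_zero.mp hc').resolve_right (sub_pos.mpr hlt).ne'⟩⟩
    · refine ⟨lm k, fun _ => ⟨⟨le_rfl, heq.le⟩, ?_⟩⟩
      have hcount : 1 < (p ^ 2 - C 4).rootMultiplicity (lm k) := by
        rw [← count_roots, hroots, Multiset.count_add]
        have h₁ : 1 ≤ ((Multiset.range N).map lp).count (lm k) :=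
          Multiset.one_le_count_iff_mem.mpr
            (Multiset.mem_map.mpr ⟨k, Multiset.mem_range.mpr (by omega), heq.symm⟩)
        have h₂ : 1 ≤ ((Multiset.range N).map (fun n => lm (n + 1))).count (lm k) :=
          Multiset.one_le_count_iff_mem.mpr
            (Multiset.mem_map.mpr ⟨k - 1, Multiset.mem_range.mpr (by omega),
              by rw [Nat.sub_add_cancel hk₁]⟩)
        omega
      have hne : p ^ 2 - C 4 ≠ 0 := by
        intro h
        rw [h] at hcount
        simp at hcount
      have hd := ((one_lt_rootMultiplicity_iff_isRoot hne).mp hcount).2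
      have hd' : 2 * p.eval (lm k) * (derivative p).eval (lm k) = 0 := by
        simpa [IsRoot, derivative_pow] using hd
      refine (mul_eq_zero.mp hd').resolve_left ?_
      rw [hm]
      simp
  choose c hc using hcrit
  have hinj : Set.InjOn c (Finset.Icc 1 (N - 1) : Finset ℕ) := by
    have key : ∀ k ∈ Finset.Icc 1 (N - 1), ∀ m ∈ Finset.Icc 1 (N - 1), k < m → c k < c m :=
      fun k hk m hm hkm => ((hc k hk).1.2.trans_lt
        (hgap k m hkm (Finset.mem_Icc.mp hm).2)).trans_le (hc m hm).1.1
    intro k hk m hm hkm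
    rcases lt_trichotomy k m with h | h | h
    · exact absurd hkm (key k hk m hm h).ne
    · exact h
    · exact absurd hkm (key m hm k hk h).ne'
  have hq : derivative p ≠ 0 := by
    intro h
    obtain ⟨z, -, hz⟩ := p.exists_slope_eq_derivative_eval (horder₁ 1 le_rfl (by omega))
    have h₁ := hΔm 1 le_rfl (by omega)
    have h₂ := hprev 1 le_rfl (by omega)
    rw [h, eval_zero, zero_mul] at hz
    rw [sub_eq_zero.mp hz.symm] at h₁
    linarith
  have hroot : ∀ t, (derivative p).eval t = 0 →
      (∃ k ∈ Finset.Icc 1 (N - 1), c k = t) ∧ (derivative (derivative p)).eval t ≠ 0 := by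
    refine fun t => exists_eq_and_derivative_ne_zero_of_card hq hinj (fun k hk => (hc k hk).2) ?_
    have h₁ := natDegree_derivative_le p
    have h₂ : p.natDegree ≤ N := natDegree_jlyap_le N a b
    rw [Nat.card_Icc]
    omega
  intro n hn hnN
  have hmem : n ∈ Finset.Icc 1 (N - 1) := Finset.mem_Icc.mpr ⟨hn, hnN⟩
  have huniq : ∀ t, lp (n - 1) < t → t ≤ lp n → (derivative p).eval t = 0 → t = c n := by
    intro t ht₁ ht₂ ht
    obtain ⟨⟨k, hk, rfl⟩, -⟩ := hroot t ht
    obtain ⟨hk₁, hk₂⟩ := Finset.mem_Icc.mp hk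
    rcases lt_trichotomy k n with h | rfl | h
    · linarith [(hc k hk).1.2, hlp (n - 1) k (by omega) (by omega)]
    · rfl
    · linarith [(hc k hk).1.1, hgap n k h hk₂]
  have hlt := horder₁ n hn (by omega)
  refine ⟨⟨c n, hc n hmem, fun t ht => huniq t (hlt.trans_le ht.1.1) ht.1.2 ht.2⟩,
    fun t ht ht' => ⟨(hroot t ht').2, ?_⟩⟩
  have hm := hΔm n hn (by omega)
  have h := (C ((-1 : ℝ) ^ (N - n)) * p).eval_le_eval_of_derivative_ne_zero hlt ht.1
    (by simp only [eval_C_mul]; rw [hprev n hn hnN, hm]; norm_num)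
    (by
      intro z hz hz'
      have hz₀ : (derivative p).eval z = 0 := by
        rw [derivative_C_mul, eval_C_mul] at hz'
        exact (mul_eq_zero.mp hz').resolve_left (by simp)
      have := huniq z hz.1 (hz.2.le.trans ht.2) hz₀
      have := huniq t (hlt.trans_le ht.1) ht.2 ht'
      linarith [hz.2])
  simpa only [eval_C_mul, hm] using h
end

section
/- Assume the polynomial Δ(λ)² − 4 has 2N real zeros labeled λ_0^+ < λ_1^- ≤ λ_1^+ < … < λ_N^- with (−1)^{N−n}Δ(λ_n^±) = 2, fix n ∈ {1,…,N−1}, and let λ_n be the unique zero of Δ' in [λ_n^-, λ_n^+]. Then for every μ ∈ [λ_n^-, λ_n^+] one has (−1)^{N−n}Δ(μ) ≤ (−1)^{N−n}Δ(λ_n); consequently, if μ_n ∈ [λ_n^-, λ_n^+] is a zero of ϑ_{N+1} and h_{1n} = log((−1)^{N−n}ϑ_N(μ_n)) (assuming (−1)^{N−n}ϑ_N(μ_n) > 0) and |h_n| = arcosh((−1)^{N−n}Δ(λ_n)/2), then |h_n|² − h_{1n}² ≥ 0. -/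
open Polynomial

/-- The inverse of `cosh` on `[1, ∞)`. -/
noncomputable def arcosh (x : ℝ) : ℝ := Real.log (x + Real.sqrt (x ^ 2 - 1))

/-- The defining three-term recurrence, evaluated at a point. -/
theorem eval_jacobiSol_add_two (a b : ℤ → ℝ) (ha : ∀ n : ℤ, 0 < a n) (y₀ y₁ : Polynomial ℝ)
    (x : ℝ) (k : ℕ) :
    a ((k : ℤ) + 1) * (jacobiSol a b y₀ y₁ (k + 2)).eval x =
      (x - b ((k : ℤ) + 1)) * (jacobiSol a b y₀ y₁ (k + 1)).eval x -
        a k * (jacobiSol a b y₀ y₁ k).eval x := by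
  have h := (ha ((k : ℤ) + 1)).ne'
  simp only [jacobiSol, eval_mul, eval_sub, eval_C, eval_X]
  field_simp

/-- Constancy of the Wronskian of the two fundamental solutions. -/
theorem wronskian_jphi_jtheta (a b : ℤ → ℝ) (ha : ∀ n : ℤ, 0 < a n) (x : ℝ) (k : ℕ) :
    a k * ((jphi a b (k + 1)).eval x * (jtheta a b k).eval x -
      (jphi a b k).eval x * (jtheta a b (k + 1)).eval x) = a 0 := by
  induction k with
  | zero => simp [jphi, jtheta, jacobiSol]
  | succ k ih =>
    have h₁ := eval_jacobiSol_add_two a b ha 0 1 x k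
    have h₂ := eval_jacobiSol_add_two a b ha 1 0 x k
    simp only [jphi, jtheta] at ih ⊢
    push_cast
    linear_combination ih + (jacobiSol a b 1 0 (k + 1)).eval x * h₁ -
      (jacobiSol a b 0 1 (k + 1)).eval x * h₂

/-- At a zero of `ϑ_{N+1}` the monodromy matrix is triangular with determinant one. -/
theorem eval_jphi_mul_eval_jtheta_eq_one {N : ℕ} {a b : ℤ → ℝ} (ha : ∀ n : ℤ, 0 < a n)
    (hap : IsPeriodicSeq N a) {x : ℝ} (hx : (jtheta a b (N + 1)).eval x = 0) :
    (jphi a b (N + 1)).eval x * (jtheta a b N).eval x = 1 := by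
  have h := wronskian_jphi_jtheta a b ha x N
  have hN : a N = a 0 := by simpa using hap 0
  rw [hx, mul_zero, sub_zero, hN] at h
  exact mul_left_cancel₀ (ha 0).ne' (h.trans (mul_one _).symm)

theorem le_arcosh_of_cosh_le {u x : ℝ} (h : Real.cosh u ≤ x) : u ≤ arcosh x := by
  have hs : Real.sinh u ≤ Real.sqrt (x ^ 2 - 1) := by
    apply Real.le_sqrt_of_sq_le
    nlinarith [Real.cosh_sq u, Real.cosh_pos u]
  have he : Real.exp u ≤ x + Real.sqrt (x ^ 2 - 1) := by
    rw [← Real.cosh_add_sinh]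
    exact add_le_add h hs
  exact (Real.le_log_iff_exp_le ((Real.exp_pos u).trans_le he)).2 he

/-- If `f` equals `2` at both ends of `[p, q]`, its only critical point there is `c`, and `f`
climbs to `2` at `p` from a smaller value without meeting the value `2`, then `f` is maximal on
`[p, q]` at `c`. -/
theorem eval_le_eval_of_unique_critical {f : Polynomial ℝ} {o p q c : ℝ} (hop : o < p)
    (ho : f.eval o < 2) (hp : f.eval p = 2) (hq : f.eval q = 2)
    (hne : ∀ x ∈ Set.Ioo o p, f.eval x ≠ 2) (hc : c ∈ Set.Icc p q)
    (hcu : ∀ t ∈ Set.Icc p q, f.derivative.eval t = 0 → t = c) :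
    ∀ x ∈ Set.Icc p q, f.eval x ≤ f.eval c := by
  obtain ⟨m, hm, hmax⟩ := isCompact_Icc.exists_isMaxOn ⟨c, hc⟩ f.continuous.continuousOn
  have hcrit : ∀ {t}, IsLocalMax (fun x => f.eval x) t → f.derivative.eval t = 0 :=
    fun h => h.hasDerivAt_eq_zero (f.hasDerivAt _)
  suffices m = c ∨ p = c ∧ f.eval m = 2 by
    intro x hx
    have h : f.eval x ≤ f.eval m := hmax hx
    rcases this with rfl | ⟨rfl, h2⟩
    · exact h
    · rwa [hp, ← h2]
  by_cases hmi : m ∈ Set.Ioo p q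
  · exact .inl (hcu m hm (hcrit (hmax.isLocalMax (Icc_mem_nhds hmi.1 hmi.2))))
  have hm2 : f.eval m = 2 := by
    rcases Set.eq_endpoints_or_mem_Ioo_of_mem_Icc hm with rfl | rfl | h
    · exact hp
    · exact hq
    · exact absurd h hmi
  refine .inr ⟨?_, hm2⟩
  rcases (hc.1.trans hc.2).eq_or_lt with rfl | hpq
  · exact le_antisymm hc.1 hc.2
  refine hcu p ⟨le_rfl, hpq.le⟩ (hcrit ?_)
  filter_upwards [Ioo_mem_nhds hop hpq] with x hx
  rw [hp]
  rcases le_or_gt p x with hpx | hxp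
  · exact hm2 ▸ hmax ⟨hpx, hx.2.le⟩
  · by_contra! h
    obtain ⟨y, hy, hy2⟩ := intermediate_value_Icc hx.1.le f.continuous.continuousOn ⟨ho.le, h.le⟩
    have hoy : o ≠ y := by
      rintro rfl
      exact ho.ne hy2
    exact hne y ⟨lt_of_le_of_ne hy.1 hoy, hy.2.trans_lt hxp⟩ hy2

/-- If `lp 0 < lm 1 ≤ lp 1 < ⋯ < lm N`, none of these points lies strictly between `lp (n - 1)`
and `lm n`. -/
theorem notMem_Ioo_of_interlacing {N : ℕ} {lm lp : ℕ → ℝ}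
    (h₁ : ∀ n : ℕ, 1 ≤ n → n ≤ N → lp (n - 1) < lm n)
    (h₂ : ∀ n : ℕ, 1 ≤ n → n ≤ N - 1 → lm n ≤ lp n) {n k : ℕ} (hn : 1 ≤ n) (hnN : n ≤ N)
    (hk : k < N) :
    lp k ∉ Set.Ioo (lp (n - 1)) (lm n) ∧ lm (k + 1) ∉ Set.Ioo (lp (n - 1)) (lm n) := by
  have hstep : ∀ j, j + 1 ≤ N - 1 → lp j ≤ lp (j + 1) := fun j hj =>
    (h₁ (j + 1) (by omega) (by omega)).le.trans (h₂ (j + 1) (by omega) hj)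
  have hmono : ∀ i j, i ≤ j → j ≤ N - 1 → lp i ≤ lp j := by
    intro i j hij
    induction j, hij using Nat.le_induction with
    | base => exact fun _ => le_rfl
    | succ j _ ih => exact fun hj => (ih (by omega)).trans (hstep j hj)
  rcases lt_or_ge k n with hkn | hkn
  · refine ⟨fun h => h.1.not_ge (hmono k (n - 1) (by omega) (by omega)), fun h => ?_⟩
    rcases (show k + 1 ≤ n from hkn).eq_or_lt with rfl | hlt
    · exact h.2.false
    · exact h.1.not_ge ((h₂ (k + 1) (by omega) (by omega)).trans
        (hmono (k + 1) (n - 1) (by omega) (by omega)))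
  · have h : lm n ≤ lp k := (h₂ n hn (by omega)).trans (hmono n k hkn (by omega))
    exact ⟨fun hI => hI.2.not_ge h,
      fun hI => hI.2.not_ge (h.trans (h₁ (k + 1) (by omega) (by omega)).le)⟩

/-- With the zeros of `Δ² − 4` labeled as before, fix `1 ≤ n ≤ N−1` and let `λ_n` be the
unique zero of `Δ'` in `[λ_n^-, λ_n^+]`.  Then `(−1)^{N−n} Δ` attains its maximum over
`[λ_n^-, λ_n^+]` at `λ_n`; consequently, if `μ_n ∈ [λ_n^-, λ_n^+]` is a zero of `ϑ_{N+1}`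
with `(−1)^{N−n} ϑ_N(μ_n) > 0`, `h_{1n} = log((−1)^{N−n} ϑ_N(μ_n))` and
`|h_n| = arcosh((−1)^{N−n} Δ(λ_n)/2)`, then `|h_n|² − h_{1n}² ≥ 0`. -/
theorem max_at_critical_point (N : ℕ) (hN : 2 ≤ N) (a b : ℤ → ℝ)
    (ha : ∀ n : ℤ, 0 < a n) (hap : IsPeriodicSeq N a) (hbp : IsPeriodicSeq N b)
    (lm lp : ℕ → ℝ)
    (hroots : ((jlyap N a b) ^ 2 - Polynomial.C 4).roots =
      (Multiset.range N).map lp + (Multiset.range N).map (fun n => lm (n + 1)))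
    (horder₁ : ∀ n : ℕ, 1 ≤ n → n ≤ N → lp (n - 1) < lm n)
    (horder₂ : ∀ n : ℕ, 1 ≤ n → n ≤ N - 1 → lm n ≤ lp n)
    (hΔm : ∀ n : ℕ, 1 ≤ n → n ≤ N → (-1 : ℝ) ^ (N - n) * (jlyap N a b).eval (lm n) = 2)
    (hΔp : ∀ n : ℕ, n ≤ N - 1 → (-1 : ℝ) ^ (N - n) * (jlyap N a b).eval (lp n) = 2)
    (n : ℕ) (hn1 : 1 ≤ n) (hn2 : n ≤ N - 1)
    (ln : ℝ) (hln : ln ∈ Set.Icc (lm n) (lp n))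
    (hln0 : (Polynomial.derivative (jlyap N a b)).eval ln = 0)
    (hlnu : ∀ t ∈ Set.Icc (lm n) (lp n),
      (Polynomial.derivative (jlyap N a b)).eval t = 0 → t = ln) :
    (∀ μ ∈ Set.Icc (lm n) (lp n),
      (-1 : ℝ) ^ (N - n) * (jlyap N a b).eval μ ≤
        (-1 : ℝ) ^ (N - n) * (jlyap N a b).eval ln) ∧
    (∀ μn ∈ Set.Icc (lm n) (lp n), (jtheta a b (N + 1)).eval μn = 0 →
      0 < (-1 : ℝ) ^ (N - n) * (jtheta a b N).eval μn →
      0 ≤ (arcosh ((-1 : ℝ) ^ (N - n) * (jlyap N a b).eval ln / 2)) ^ 2 -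
        (Real.log ((-1 : ℝ) ^ (N - n) * (jtheta a b N).eval μn)) ^ 2) := by
  have hs : (-1 : ℝ) ^ (N - n) * (-1 : ℝ) ^ (N - n) = 1 := by
    rw [← mul_pow]
    norm_num
  have hsucc : (-1 : ℝ) ^ (N - (n - 1)) = -(-1 : ℝ) ^ (N - n) := by
    rw [show N - (n - 1) = N - n + 1 by omega, pow_succ, mul_neg_one]
  set s : ℝ := (-1 : ℝ) ^ (N - n)
  have hne0 : (jlyap N a b) ^ 2 - Polynomial.C 4 ≠ 0 := by
    intro h
    have h0 := congrArg Multiset.card hroots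
    simp [h] at h0
    omega
  have hne : ∀ x ∈ Set.Ioo (lp (n - 1)) (lm n), s * (jlyap N a b).eval x ≠ 2 := by
    intro x hx h
    have hroot : x ∈ ((jlyap N a b) ^ 2 - Polynomial.C 4).roots := by
      rw [mem_roots hne0, IsRoot, eval_sub, eval_pow, eval_C]
      linear_combination (s * (jlyap N a b).eval x + 2) * h - ((jlyap N a b).eval x) ^ 2 * hs
    rw [hroots, Multiset.mem_add, Multiset.mem_map, Multiset.mem_map] at hroot
    rcases hroot with ⟨k, hk, rfl⟩ | ⟨k, hk, rfl⟩
    · exact (notMem_Ioo_of_interlacing horder₁ horder₂ hn1 (by omega)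
        (Multiset.mem_range.1 hk)).1 hx
    · exact (notMem_Ioo_of_interlacing horder₁ horder₂ hn1 (by omega)
        (Multiset.mem_range.1 hk)).2 hx
  have hmax : ∀ μ ∈ Set.Icc (lm n) (lp n),
      s * (jlyap N a b).eval μ ≤ s * (jlyap N a b).eval ln := by
    have hprev := hΔp (n - 1) (by omega)
    rw [hsucc] at hprev
    have h := eval_le_eval_of_unique_critical (f := C s * jlyap N a b) (c := ln)
      (horder₁ n hn1 (by omega)) (by rw [eval_mul, eval_C]; linarith)
      (by rw [eval_mul, eval_C]; exact hΔm n hn1 (by omega))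
      (by rw [eval_mul, eval_C]; exact hΔp n hn2)
      (fun x hx => by rw [eval_mul, eval_C]; exact hne x hx) hln (by
        intro t ht h
        rw [derivative_C_mul, eval_mul, eval_C] at h
        exact hlnu t ht ((mul_eq_zero.1 h).resolve_left (left_ne_zero_of_mul_eq_one hs)))
    simpa only [eval_mul, eval_C] using h
  refine ⟨hmax, fun μn hμ hθ hpos => ?_⟩
  have hW := eval_jphi_mul_eval_jtheta_eq_one ha hap hθ
  have hinv : (s * (jtheta a b N).eval μn)⁻¹ = s * (jphi a b (N + 1)).eval μn :=
    inv_eq_of_mul_eq_one_right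
      (by linear_combination hs * ((jphi a b (N + 1)).eval μn * (jtheta a b N).eval μn) + hW)
  have hcosh : Real.cosh |Real.log (s * (jtheta a b N).eval μn)| ≤
      s * (jlyap N a b).eval ln / 2 := by
    rw [Real.cosh_abs, Real.cosh_log hpos, hinv]
    have h := hmax μn hμ
    rw [jlyap, eval_add] at h
    rw [jlyap]
    linarith
  have habs := le_arcosh_of_cosh_le hcosh
  rw [sub_nonneg, ← sq_abs (Real.log _)]
  exact pow_le_pow_left₀ (abs_nonneg _) habs 2
end
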